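/- arXiv:2204.10605 — 6 statements merged into one kernel-verified Lean document; each statement's English description precedes it below -/
import Mathlib

section
/- Let t0 ≥ 0, r1 ∈ [0,1], r2 with r1 ≤ r2 ≤ 2·r1, A > 1 with A ≤ (1 + t0)^{r1}, and B ≥ 0. Let φ(t), t = 0, 1, 2, …, be a sequence of real numbers satisfying φ(t) = (1 − A/(t + t0)^{r1}) φ(t−1) + B/(t + t0)^{r2} for all t ≥ 1. Then for every t ≥ 0, φ(t) ≤ Q/(t + t0 + 1)^{r2 − r1}, where Q = max{ φ(0)·(t0 + 1)^{r2 − r1}, B/(A − 1) }. -/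
/-- For `x ≥ 1`, `r ≤ 1` and `s ≤ 1`, passing from `x ^ (-s)` to `(x + 1) ^ (-s)` loses at most
the factor `1 - x ^ (-r)`. -/
theorem one_sub_inv_rpow_div_rpow_le {x r s : ℝ} (hx : 1 ≤ x) (hr : r ≤ 1) (hs : s ≤ 1) :
    (1 - 1 / x ^ r) / x ^ s ≤ 1 / (x + 1) ^ s := by
  have hx0 : 0 < x := by linarith
  have hy0 : 0 < x + 1 := by linarith
  have hu : 0 < x ^ s := Real.rpow_pos_of_pos hx0 s
  have hw : 0 < x ^ r := Real.rpow_pos_of_pos hx0 r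
  have hwx : x ^ r ≤ x := by
    simpa using Real.rpow_le_rpow_of_exponent_le hx hr
  have hratio : x / (x + 1) ≤ x ^ s / (x + 1) ^ s := by
    rw [← Real.div_rpow hx0.le hy0.le]
    simpa using Real.rpow_le_rpow_of_exponent_ge (div_pos hx0 hy0)
      ((div_le_one hy0).2 (by linarith)) hs
  have hinv : 1 / (x + 1) ≤ 1 / x ^ r := one_div_le_one_div_of_le hw (by linarith)
  have hsplit : x / (x + 1) = 1 - 1 / (x + 1) := by field_simp; ring
  rw [div_le_iff₀ hu, one_div_mul_eq_div]
  linarith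

/-- Lemma 3 (descent lemma for recursively defined sequences): if
`φ(t) = (1 − A/(t+t0)^{r1}) φ(t−1) + B/(t+t0)^{r2}` for all `t ≥ 1`, with
`t0 ≥ 0`, `0 ≤ r1 ≤ 1`, `r1 ≤ r2 ≤ 2 r1`, `1 < A ≤ (1+t0)^{r1}`, `B ≥ 0`,
then `φ(t) ≤ Q/(t + t0 + 1)^{r2 − r1}` with
`Q = max { φ(0)(t0+1)^{r2−r1}, B/(A−1) }`. -/
theorem phi_descent (t0 r1 r2 A B : ℝ) (φ : ℕ → ℝ)
    (ht0 : 0 ≤ t0) (hr1l : 0 ≤ r1) (hr1u : r1 ≤ 1)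
    (hr12 : r1 ≤ r2) (hr22 : r2 ≤ 2 * r1)
    (hA : 1 < A) (hAle : A ≤ (1 + t0) ^ r1) (hB : 0 ≤ B)
    (hrec : ∀ t : ℕ, 1 ≤ t →
      φ t = (1 - A / ((t : ℝ) + t0) ^ r1) * φ (t - 1) + B / ((t : ℝ) + t0) ^ r2) :
    ∀ t : ℕ,
      φ t ≤ max (φ 0 * (t0 + 1) ^ (r2 - r1)) (B / (A - 1)) /
        ((t : ℝ) + t0 + 1) ^ (r2 - r1) := by
  have hA1 : 0 < A - 1 := by linarith
  set Q := max (φ 0 * (t0 + 1) ^ (r2 - r1)) (B / (A - 1))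
  have hQB : B ≤ Q * (A - 1) := (div_le_iff₀ hA1).1 (le_max_right _ _)
  have hQ : 0 ≤ Q := (div_nonneg hB hA1.le).trans (le_max_right _ _)
  intro t
  induction t with
  | zero =>
    rw [Nat.cast_zero, zero_add, le_div_iff₀ (Real.rpow_pos_of_pos (by linarith) _)]
    exact le_max_left _ _
  | succ n ih =>
    have hstep := hrec (n + 1) n.succ_pos
    rw [Nat.add_sub_cancel] at hstep
    have hcast : ((n + 1 : ℕ) : ℝ) + t0 = (n : ℝ) + t0 + 1 := by push_cast; ring
    rw [hcast] at hstep ⊢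
    have hn : (0 : ℝ) ≤ n := n.cast_nonneg
    set x := (n : ℝ) + t0 + 1
    have hx : 1 + t0 ≤ x := by simp only [x]; linarith
    have hx0 : 0 < x := by linarith
    have hu : 0 < x ^ (r2 - r1) := Real.rpow_pos_of_pos hx0 _
    have hw : 0 < x ^ r1 := Real.rpow_pos_of_pos hx0 _
    have hmul : x ^ r2 = x ^ r1 * x ^ (r2 - r1) := by
      rw [← Real.rpow_add hx0]; congr 1; ring
    have hcoef : 0 ≤ 1 - A / x ^ r1 :=
      sub_nonneg.2 ((div_le_one hw).2
        (hAle.trans (Real.rpow_le_rpow (by linarith) hx hr1l)))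
    calc φ (n + 1) = (1 - A / x ^ r1) * φ n + B / x ^ r2 := hstep
      _ ≤ (1 - A / x ^ r1) * (Q / x ^ (r2 - r1)) + Q * (A - 1) / x ^ r2 := by gcongr
      _ = Q * ((1 - 1 / x ^ r1) / x ^ (r2 - r1)) := by rw [hmul]; field_simp; ring
      _ ≤ Q * (1 / (x + 1) ^ (r2 - r1)) :=
        mul_le_mul_of_nonneg_left
          (one_sub_inv_rpow_div_rpow_le (by linarith) hr1u (by linarith)) hQ
      _ = Q / (x + 1) ^ (r2 - r1) := mul_one_div _ _
end

section
/- Under the stated setup, for every k ≥ 1 one has √(Σ_{i=1}^m ‖x̄_i^k − x̄^k‖²) ≤ C_p γ_k; in particular max_{i∈{1,…,m}} ‖x̄_i^k − x̄^k‖ ≤ C_p γ_k. -/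
/-- Minkowski's inequality for families of vectors. -/
theorem sqrt_sum_norm_add_sq_le {ι E : Type*} [Fintype ι] [NormedAddCommGroup E]
    (a b : ι → E) :
    Real.sqrt (∑ i, ‖a i + b i‖ ^ 2) ≤
      Real.sqrt (∑ i, ‖a i‖ ^ 2) + Real.sqrt (∑ i, ‖b i‖ ^ 2) := by
  have h := norm_add_le (WithLp.toLp 2 a : PiLp 2 fun _ : ι => E) (WithLp.toLp 2 b)
  simpa [PiLp.norm_eq_of_L2] using h

theorem sqrt_sum_norm_smul_sq {ι E : Type*} [Fintype ι] [NormedAddCommGroup E]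
    [NormedSpace ℝ E] {c : ℝ} (hc : 0 ≤ c) (a : ι → E) :
    Real.sqrt (∑ i, ‖c • a i‖ ^ 2) = c * Real.sqrt (∑ i, ‖a i‖ ^ 2) := by
  simp_rw [norm_smul, mul_pow, ← Finset.mul_sum]
  rw [Real.sqrt_mul (by positivity), Real.norm_of_nonneg hc, Real.sqrt_sq hc]

theorem sqrt_sum_norm_sq_le {ι E : Type*} [Fintype ι] [NormedAddCommGroup E]
    {r : ℝ} (hr : 0 ≤ r) (a : ι → E) (ha : ∀ i, ‖a i‖ ≤ r) :
    Real.sqrt (∑ i, ‖a i‖ ^ 2) ≤ Real.sqrt (Fintype.card ι) * r := by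
  have h : ∑ i, ‖a i‖ ^ 2 ≤ Fintype.card ι * r ^ 2 := by
    calc ∑ i, ‖a i‖ ^ 2 ≤ ∑ _i : ι, r ^ 2 :=
          Finset.sum_le_sum fun i _ => pow_le_pow_left₀ (norm_nonneg _) (ha i) 2
      _ = _ := by simp
  calc _ ≤ Real.sqrt (Fintype.card ι * r ^ 2) := Real.sqrt_le_sqrt h
    _ = _ := by rw [Real.sqrt_mul (by positivity), Real.sqrt_sq hr]

/-- A contraction estimate for a matrix on the scalar vectors of sum zero extends to families of
Euclidean vectors of sum zero. -/
theorem sqrt_sum_norm_mix_sq_le {ι κ : Type*} [Fintype ι] [Fintype κ] {W : Matrix ι ι ℝ} {lam : ℝ}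
    (hlam0 : 0 ≤ lam)
    (hW : ∀ y : ι → ℝ, ∑ i, y i = 0 →
      Real.sqrt (∑ i, (∑ j, W i j * y j) ^ 2) ≤ lam * Real.sqrt (∑ i, (y i) ^ 2))
    (y : ι → EuclideanSpace ℝ κ) (hy : ∑ i, y i = 0) :
    Real.sqrt (∑ i, ‖∑ j, W i j • y j‖ ^ 2) ≤ lam * Real.sqrt (∑ i, ‖y i‖ ^ 2) := by
  have hcoord (c : κ) : ∑ i, (∑ j, W i j * y j c) ^ 2 ≤ lam ^ 2 * ∑ i, (y i c) ^ 2 := by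
    have hc : ∑ i, y i c = 0 := by
      simpa using congrArg (fun v : EuclideanSpace ℝ κ => v c) hy
    have h := pow_le_pow_left₀ (Real.sqrt_nonneg _) (hW (fun i => y i c) hc) 2
    rwa [mul_pow, Real.sq_sqrt (by positivity), Real.sq_sqrt (by positivity)] at h
  refine Real.sqrt_le_iff.2 ⟨by positivity, ?_⟩
  rw [mul_pow, Real.sq_sqrt (by positivity)]
  simp only [EuclideanSpace.real_norm_sq_eq]
  rw [Finset.sum_comm, Finset.sum_comm (f := fun i c => (y i c) ^ 2), Finset.mul_sum]
  refine Finset.sum_le_sum fun c _ => ?_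
  simpa using hcoord c

/-- The mean of a nonempty family of points of a convex set lies in the set. -/
theorem Convex.inv_card_smul_sum_mem {ι E : Type*} [Fintype ι] [Nonempty ι] [AddCommGroup E]
    [Module ℝ E] {s : Set E} (hs : Convex ℝ s) {z : ι → E} (hz : ∀ i, z i ∈ s) :
    (Fintype.card ι : ℝ)⁻¹ • ∑ i, z i ∈ s := by
  rw [Finset.smul_sum]
  exact hs.sum_mem (fun _ _ => by positivity) (by simp) fun i _ => hz i


theorem consensus_error_bound (d m : ℕ) (hm : 0 < m)
    (Ω : Set (EuclideanSpace ℝ (Fin d))) (hne : Ω.Nonempty)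
    (hconv : Convex ℝ Ω) (hcomp : IsCompact Ω)
    (ρ : ℝ) (hρ : ρ = Metric.diam Ω)
    (W : Matrix (Fin m) (Fin m) ℝ) (hWnn : ∀ i j, 0 ≤ W i j)
    (hrow : ∀ i, ∑ j, W i j = 1) (hcol : ∀ j, ∑ i, W i j = 1)
    (lam : ℝ) (hlam0 : 0 ≤ lam) (hlam1 : lam < 1)
    (hW : ∀ y : Fin m → ℝ, ∑ i, y i = 0 →
      Real.sqrt (∑ i, (∑ j, W i j * y j) ^ 2) ≤ lam * Real.sqrt (∑ i, (y i) ^ 2))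
    (α : ℝ) (hα0 : 0 < α) (hα1 : α ≤ 1)
    (γ : ℕ → ℝ) (hγ : ∀ k, γ k = (k : ℝ) ^ (-α))
    (k₀ : ℕ) (hk₀ : 1 ≤ k₀)
    (hk₀lam : lam ≤ ((k₀ : ℝ) / ((k₀ : ℝ) + 1)) ^ α * (1 + (k₀ : ℝ) ^ (-α))⁻¹)
    (Cp : ℝ) (hCp : Cp = (k₀ : ℝ) ^ α * Real.sqrt (m : ℝ) * ρ)
    (x u : Fin m → ℕ → EuclideanSpace ℝ (Fin d))
    (hx1 : ∀ i, x i 1 ∈ Ω) (hu : ∀ i k, 1 ≤ k → u i k ∈ Ω)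
    (hrec : ∀ i k, 1 ≤ k →
      x i (k + 1) = (1 - γ k) • (∑ j, W i j • x j k) + γ k • u i k) :
    ∀ k, 1 ≤ k →
      Real.sqrt (∑ i, ‖(∑ j, W i j • x j k) - (m : ℝ)⁻¹ • ∑ j, x j k‖ ^ 2) ≤ Cp * γ k ∧
      ∀ i, ‖(∑ j, W i j • x j k) - (m : ℝ)⁻¹ • ∑ j, x j k‖ ≤ Cp * γ k := by
  subst hρ
  have : Nonempty (Fin m) := ⟨⟨0, hm⟩⟩
  have hm' : (m : ℝ) ≠ 0 := by positivity
  have hdist {p q : EuclideanSpace ℝ (Fin d)} (hp : p ∈ Ω) (hq : q ∈ Ω) :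
      ‖p - q‖ ≤ Metric.diam Ω := by
    rw [← dist_eq_norm]
    exact Metric.dist_le_diam_of_mem hcomp.isBounded hp hq
  have hmean {z : Fin m → EuclideanSpace ℝ (Fin d)} (hz : ∀ i, z i ∈ Ω) :
      (m : ℝ)⁻¹ • ∑ j, z j ∈ Ω := by
    simpa using hconv.inv_card_smul_sum_mem hz
  have hmix {z : Fin m → EuclideanSpace ℝ (Fin d)} (hz : ∀ i, z i ∈ Ω) (i : Fin m) :
      ∑ j, W i j • z j ∈ Ω :=
    hconv.sum_mem (fun j _ => hWnn i j) (hrow i) fun j _ => hz j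
  have hspread {z w : Fin m → EuclideanSpace ℝ (Fin d)} (hz : ∀ i, z i ∈ Ω)
      (hw : ∀ i, w i ∈ Ω) :
      Real.sqrt (∑ i, ‖z i - w i‖ ^ 2) ≤ Real.sqrt m * Metric.diam Ω := by
    simpa using sqrt_sum_norm_sq_le Metric.diam_nonneg (fun i => z i - w i)
      fun i => hdist (hz i) (hw i)
  have hγ0 (k : ℕ) : 0 ≤ γ k := by rw [hγ]; positivity
  have hγ1 {k : ℕ} (hk : 1 ≤ k) : γ k ≤ 1 := by
    rw [hγ]
    exact Real.rpow_le_one_of_one_le_of_nonpos (by exact_mod_cast hk) (by linarith)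
  have hxΩ : ∀ k, 1 ≤ k → ∀ i, x i k ∈ Ω := by
    intro k hk
    induction k, hk using Nat.le_induction with
    | base => exact hx1
    | succ k hk ih =>
      intro i
      rw [hrec i k hk]
      exact hconv (hmix ih i) (hu i k hk) (by linarith [hγ1 hk]) (hγ0 k) (by ring)
  have hk₀pos : (0 : ℝ) < k₀ := by exact_mod_cast hk₀
  have hCp0 : 0 ≤ Cp := by
    rw [hCp]
    have := Metric.diam_nonneg (s := Ω)
    positivity
  have hk₀cancel : (k₀ : ℝ) ^ α * (k₀ : ℝ) ^ (-α) = 1 := by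
    rw [← Real.rpow_add hk₀pos, add_neg_cancel, Real.rpow_zero]
  have hCpk₀ : Real.sqrt m * Metric.diam Ω = Cp * (k₀ : ℝ) ^ (-α) := by
    rw [hCp]
    linear_combination (-(Real.sqrt m * Metric.diam Ω)) * hk₀cancel
  have hsmall (k : ℕ) (hk : 1 ≤ k) (hkk : k ≤ k₀) :
      Real.sqrt (∑ i, ‖(∑ j, W i j • x j k) - (m : ℝ)⁻¹ • ∑ j, x j k‖ ^ 2) ≤ Cp * γ k := by
    refine (hspread (hmix (hxΩ k hk)) fun _ => hmean (hxΩ k hk)).trans ?_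
    rw [hCpk₀, hγ]
    refine mul_le_mul_of_nonneg_left ?_ hCp0
    exact Real.rpow_le_rpow_of_nonpos (by exact_mod_cast hk) (by exact_mod_cast hkk) (by linarith)
  have hcontract (k : ℕ) (hk : 1 ≤ k) :
      Real.sqrt (∑ i, ‖(∑ j, W i j • x j (k + 1)) - (m : ℝ)⁻¹ • ∑ j, x j (k + 1)‖ ^ 2) ≤
        lam * ((1 - γ k) *
          Real.sqrt (∑ i, ‖(∑ j, W i j • x j k) - (m : ℝ)⁻¹ • ∑ j, x j k‖ ^ 2) +
          γ k * (Real.sqrt m * Metric.diam Ω)) := by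
    have hsum_mix : ∑ i, ∑ j, W i j • x j k = ∑ j, x j k := by
      rw [Finset.sum_comm]
      simp_rw [← Finset.sum_smul, hcol, one_smul]
    have hmean_succ : (m : ℝ)⁻¹ • ∑ j, x j (k + 1) =
        (1 - γ k) • ((m : ℝ)⁻¹ • ∑ j, x j k) + γ k • ((m : ℝ)⁻¹ • ∑ j, u j k) := by
      simp_rw [hrec _ k hk, Finset.sum_add_distrib, ← Finset.smul_sum, hsum_mix, smul_add]
      rw [smul_comm, smul_comm (γ k)]
    have hdev (i : Fin m) : x i (k + 1) - (m : ℝ)⁻¹ • ∑ j, x j (k + 1) =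
        (1 - γ k) • ((∑ j, W i j • x j k) - (m : ℝ)⁻¹ • ∑ j, x j k) +
          γ k • (u i k - (m : ℝ)⁻¹ • ∑ j, u j k) := by
      rw [hmean_succ, hrec i k hk]
      module
    have hmix_dev (i : Fin m) : (∑ j, W i j • x j (k + 1)) - (m : ℝ)⁻¹ • ∑ j, x j (k + 1) =
        ∑ j, W i j • (x j (k + 1) - (m : ℝ)⁻¹ • ∑ l, x l (k + 1)) := by
      simp_rw [smul_sub, Finset.sum_sub_distrib, ← Finset.sum_smul, hrow, one_smul]
    have hzero : ∑ i, (x i (k + 1) - (m : ℝ)⁻¹ • ∑ j, x j (k + 1)) = 0 := by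
      rw [Finset.sum_sub_distrib, Finset.sum_const, Finset.card_univ, Fintype.card_fin,
        ← Nat.cast_smul_eq_nsmul ℝ, smul_inv_smul₀ hm', sub_self]
    simp_rw [hmix_dev (_ : Fin m)]
    refine (sqrt_sum_norm_mix_sq_le hlam0 hW _ hzero).trans ?_
    refine mul_le_mul_of_nonneg_left ?_ hlam0
    simp_rw [hdev]
    refine (sqrt_sum_norm_add_sq_le _ _).trans ?_
    rw [sqrt_sum_norm_smul_sq (by linarith [hγ1 hk]), sqrt_sum_norm_smul_sq (hγ0 k)]
    gcongr
    · exact hγ0 k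
    · exact hspread (hu · k hk) fun _ => hmean (hu · k hk)
  have hstep (k : ℕ) (hkk : k₀ ≤ k) : lam * (1 + (k₀ : ℝ) ^ (-α)) * γ k ≤ γ (k + 1) := by
    have hkpos : (0 : ℝ) < k := by exact_mod_cast hk₀.trans hkk
    have hratio : ((k₀ : ℝ) / (k₀ + 1)) ^ α ≤ ((k : ℝ) / (k + 1)) ^ α := by
      refine Real.rpow_le_rpow (by positivity) ?_ hα0.le
      have : (k₀ : ℝ) ≤ k := by exact_mod_cast hkk
      rw [div_le_div_iff₀ (by positivity) (by positivity)]
      linarith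
    have hlam : lam * (1 + (k₀ : ℝ) ^ (-α)) ≤ ((k : ℝ) / (k + 1)) ^ α := by
      rw [← div_eq_mul_inv, le_div_iff₀ (by positivity)] at hk₀lam
      exact hk₀lam.trans hratio
    refine (mul_le_mul_of_nonneg_right hlam (hγ0 k)).trans_eq ?_
    rw [hγ, hγ, Real.div_rpow (by positivity) (by positivity), Real.rpow_neg (by positivity),
      Real.rpow_neg (by positivity)]
    push_cast
    field_simp
  have hmain (k : ℕ) (hk : 1 ≤ k) :
      Real.sqrt (∑ i, ‖(∑ j, W i j • x j k) - (m : ℝ)⁻¹ • ∑ j, x j k‖ ^ 2) ≤ Cp * γ k := by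
    induction k, hk using Nat.le_induction with
    | base => exact hsmall 1 le_rfl hk₀
    | succ k hk ih =>
      rcases le_or_gt (k + 1) k₀ with hkk | hkk
      · exact hsmall (k + 1) (by lia) hkk
      · calc
          _ ≤ _ := hcontract k hk
          _ ≤ lam * (1 * (Cp * γ k) + γ k * (Cp * (k₀ : ℝ) ^ (-α))) := by
            rw [hCpk₀]
            gcongr
            linarith [hγ0 k]
          _ = Cp * (lam * (1 + (k₀ : ℝ) ^ (-α)) * γ k) := by ring
          _ ≤ Cp * γ (k + 1) := mul_le_mul_of_nonneg_left (hstep k (by lia)) hCp0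
  refine fun k hk => ⟨hmain k hk, fun i => le_trans ?_ (hmain k hk)⟩
  exact Real.le_sqrt_of_sq_le (Finset.single_le_sum
    (f := fun i => ‖(∑ j, W i j • x j k) - (m : ℝ)⁻¹ • ∑ j, x j k‖ ^ 2)
    (fun _ _ => by positivity) (Finset.mem_univ i))
end

section
/- Under the stated setup, for every agent i ∈ {1,…,m} and every k ≥ 1 one has ‖x_i^k − x̄^k‖ ≤ (2ρ̄ + 3C_p)·2^α·γ_k; in particular each local iterate satisfies ‖x_i^k − x̄^k‖ = O(1/k^α), i.e., the agents reach consensus at rate k^{−α}. -/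
theorem norm_toLp_le_sqrt_card_mul {m : ℕ} {E : Type*} [SeminormedAddCommGroup E]
    (y : Fin m → E) {c : ℝ} (hc : 0 ≤ c) (h : ∀ i, ‖y i‖ ≤ c) :
    ‖WithLp.toLp 2 y‖ ≤ Real.sqrt m * c := by
  rw [PiLp.norm_eq_of_L2]
  apply Real.sqrt_le_iff.mpr
  refine ⟨by positivity, ?_⟩
  rw [mul_pow, Real.sq_sqrt (Nat.cast_nonneg m)]
  calc ∑ i, ‖y i‖ ^ 2 ≤ ∑ _i : Fin m, c ^ 2 :=
        Finset.sum_le_sum fun i _ => pow_le_pow_left₀ (norm_nonneg _) (h i) 2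
    _ = m * c ^ 2 := by simp

/-- A contraction estimate for `W` on zero-sum real vectors extends to zero-sum families of
Euclidean vectors. -/
theorem norm_toLp_weighted_sum_le {d m : ℕ} (W : Matrix (Fin m) (Fin m) ℝ) {lam : ℝ}
    (hlam0 : 0 ≤ lam)
    (hW : ∀ y : Fin m → ℝ, ∑ i, y i = 0 →
      Real.sqrt (∑ i, (∑ j, W i j * y j) ^ 2) ≤ lam * Real.sqrt (∑ i, (y i) ^ 2))
    (y : Fin m → EuclideanSpace ℝ (Fin d)) (hy : ∑ i, y i = 0) :
    ‖WithLp.toLp 2 (fun i => ∑ j, W i j • y j)‖ ≤ lam * ‖WithLp.toLp 2 y‖ := by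
  have hcoord : ∀ c, ∑ i, (∑ j, W i j * y j c) ^ 2 ≤ lam ^ 2 * ∑ i, (y i c) ^ 2 := by
    intro c
    have h0 : ∑ i, y i c = 0 := by
      simpa using congrArg (fun v : EuclideanSpace ℝ (Fin d) => v c) hy
    have h := (Real.sqrt_le_iff.mp (hW (fun i => y i c) h0)).2
    rwa [mul_pow, Real.sq_sqrt (Finset.sum_nonneg fun i _ => sq_nonneg _)] at h
  rw [PiLp.norm_eq_of_L2, PiLp.norm_eq_of_L2]
  apply Real.sqrt_le_iff.mpr
  refine ⟨by positivity, ?_⟩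
  rw [mul_pow, Real.sq_sqrt (Finset.sum_nonneg fun i _ => sq_nonneg _)]
  simp only [EuclideanSpace.real_norm_sq_eq]
  rw [Finset.sum_comm, Finset.sum_comm (f := fun i c => (y i c) ^ 2), Finset.mul_sum]
  refine Finset.sum_le_sum fun c _ => ?_
  simpa using hcoord c


theorem consensus_rate (d m : ℕ) (hm : 0 < m)
    (Ω : Set (EuclideanSpace ℝ (Fin d))) (hne : Ω.Nonempty)
    (hconv : Convex ℝ Ω) (hcomp : IsCompact Ω)
    (ρ : ℝ) (hρ : ρ = Metric.diam Ω)
    (W : Matrix (Fin m) (Fin m) ℝ) (hWnn : ∀ i j, 0 ≤ W i j)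
    (hrow : ∀ i, ∑ j, W i j = 1) (hcol : ∀ j, ∑ i, W i j = 1)
    (lam : ℝ) (hlam0 : 0 ≤ lam) (hlam1 : lam < 1)
    (hW : ∀ y : Fin m → ℝ, ∑ i, y i = 0 →
      Real.sqrt (∑ i, (∑ j, W i j * y j) ^ 2) ≤ lam * Real.sqrt (∑ i, (y i) ^ 2))
    (α : ℝ) (hα0 : 0 < α) (hα1 : α ≤ 1)
    (γ : ℕ → ℝ) (hγ : ∀ k, γ k = (k : ℝ) ^ (-α))
    (k₀ : ℕ) (hk₀ : 1 ≤ k₀)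
    (hk₀lam : lam ≤ ((k₀ : ℝ) / ((k₀ : ℝ) + 1)) ^ α * (1 + (k₀ : ℝ) ^ (-α))⁻¹)
    (Cp : ℝ) (hCp : Cp = (k₀ : ℝ) ^ α * Real.sqrt (m : ℝ) * ρ)
    (x u : Fin m → ℕ → EuclideanSpace ℝ (Fin d))
    (hx1 : ∀ i, x i 1 ∈ Ω) (hu : ∀ i k, 1 ≤ k → u i k ∈ Ω)
    (hrec : ∀ i k, 1 ≤ k →
      x i (k + 1) = (1 - γ k) • (∑ j, W i j • x j k) + γ k • u i k) :
    ∀ i, ∀ k, 1 ≤ k →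
      ‖x i k - (m : ℝ)⁻¹ • ∑ j, x j k‖ ≤ (2 * ρ + 3 * Cp) * 2 ^ α * γ k := by
  have hm' : (m : ℝ) ≠ 0 := by positivity
  have hρ0 : 0 ≤ ρ := hρ ▸ Metric.diam_nonneg
  have hdist : ∀ p ∈ Ω, ∀ q ∈ Ω, ‖p - q‖ ≤ ρ := fun p hp q hq => by
    rw [hρ, ← dist_eq_norm]
    exact Metric.dist_le_diam_of_mem hcomp.isBounded hp hq
  have hγ0 : ∀ k, 0 ≤ γ k := fun k => by rw [hγ]; positivity
  have hγ1 : ∀ k, 1 ≤ k → γ k ≤ 1 := fun k hk => by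
    rw [hγ]
    exact Real.rpow_le_one_of_one_le_of_nonpos (by exact_mod_cast hk) (by linarith)
  have hratio : ∀ k, 1 ≤ k → γ k * ((k : ℝ) / (k + 1)) ^ α = γ (k + 1) := by
    intro k hk
    have hk' : (0 : ℝ) < k := by exact_mod_cast hk
    rw [hγ, hγ, Real.div_rpow hk'.le (by positivity), Real.rpow_neg hk'.le,
      Real.rpow_neg (by positivity)]
    push_cast
    field_simp
  have hmean : ∀ w : Fin m → EuclideanSpace ℝ (Fin d), (∀ i, w i ∈ Ω) →
      (m : ℝ)⁻¹ • ∑ j, w j ∈ Ω := by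
    intro w hw
    rw [Finset.smul_sum]
    exact hconv.sum_mem (fun _ _ => by positivity) (by simp [hm']) fun i _ => hw i
  have hxΩ : ∀ k, 1 ≤ k → ∀ i, x i k ∈ Ω := by
    intro k hk
    induction k, hk using Nat.le_induction with
    | base => exact hx1
    | succ k hk ih =>
      intro i
      rw [hrec i k hk]
      exact hconv (hconv.sum_mem (fun j _ => hWnn i j) (hrow i) fun j _ => ih j) (hu i k hk)
        (sub_nonneg.mpr (hγ1 k hk)) (hγ0 k) (by ring)
  set a : ℕ → EuclideanSpace ℝ (Fin d) := fun k => (m : ℝ)⁻¹ • ∑ j, x j k with ha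
  set b : ℕ → EuclideanSpace ℝ (Fin d) := fun k => (m : ℝ)⁻¹ • ∑ j, u j k with hb
  set v : Fin m → ℕ → EuclideanSpace ℝ (Fin d) := fun i k => ∑ j, W i j • x j k with hv
  have hvsum : ∀ k, ∑ i, v i k = ∑ j, x j k := by
    intro k
    simp only [hv]
    rw [Finset.sum_comm]
    simp [← Finset.sum_smul, hcol]
  have hasucc : ∀ k, 1 ≤ k → a (k + 1) = (1 - γ k) • a k + γ k • b k := by
    intro k hk
    have : ∑ j, x j (k + 1) = (1 - γ k) • ∑ j, x j k + γ k • ∑ j, u j k := by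
      rw [← hvsum k, Finset.smul_sum, Finset.smul_sum, ← Finset.sum_add_distrib]
      exact Finset.sum_congr rfl fun j _ => hrec j k hk
    simp only [ha, hb, this]
    module
  have hdev : ∀ i k, 1 ≤ k →
      x i (k + 1) - a (k + 1) = (1 - γ k) • (v i k - a k) + γ k • (u i k - b k) := by
    intro i k hk
    rw [hasucc k hk, hrec i k hk]
    module
  have hvdev : ∀ i k, v i k - a k = ∑ j, W i j • (x j k - a k) := by
    intro i k
    simp [smul_sub, Finset.sum_sub_distrib, ← Finset.sum_smul, hrow, hv]
  have hsum0 : ∀ k, ∑ j, (x j k - a k) = 0 := by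
    intro k
    simp [ha, Finset.sum_sub_distrib, ← Nat.cast_smul_eq_nsmul ℝ, smul_smul, hm']
  have hu_dev : ∀ i k, 1 ≤ k → ‖u i k - b k‖ ≤ ρ := fun i k hk =>
    hdist _ (hu i k hk) _ (hmean (u · k) fun j => hu j k hk)
  have hv_dev : ∀ i k, 1 ≤ k → ‖v i k - a k‖ ≤ ρ := fun i k hk =>
    hdist _ (hconv.sum_mem (fun j _ => hWnn i j) (hrow i) fun j _ => hxΩ k hk j) _
      (hmean (x · k) fun j => hxΩ k hk j)
  have hCp0 : 0 ≤ Cp := by rw [hCp]; positivity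
  have hk₀pos : (0 : ℝ) < k₀ := by exact_mod_cast hk₀
  have hCpγ : Cp * γ k₀ = Real.sqrt m * ρ := by
    rw [hCp, hγ, Real.rpow_neg hk₀pos.le]
    field_simp
  have hlamγ : lam * (1 + γ k₀) ≤ ((k₀ : ℝ) / (k₀ + 1)) ^ α := by
    have h1 : 0 < 1 + γ k₀ := by linarith [hγ0 k₀]
    rw [← hγ, ← div_eq_mul_inv] at hk₀lam
    exact (le_div_iff₀ h1).mp hk₀lam
  have hsmall : ∀ k, 1 ≤ k → k ≤ k₀ →
      ‖WithLp.toLp 2 (fun i => v i k - a k)‖ ≤ Cp * γ k := by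
    intro k hk hkk
    refine (norm_toLp_le_sqrt_card_mul _ hρ0 fun i => hv_dev i k hk).trans ?_
    rw [← hCpγ, hγ, hγ]
    exact mul_le_mul_of_nonneg_left (Real.rpow_le_rpow_of_nonpos (by exact_mod_cast hk)
      (by exact_mod_cast hkk) (by linarith)) hCp0
  have hlarge : ∀ k, k₀ ≤ k → ‖WithLp.toLp 2 (fun i => v i k - a k)‖ ≤ Cp * γ k := by
    intro k hk
    induction k, hk using Nat.le_induction with
    | base => exact hsmall k₀ hk₀ le_rfl
    | succ k hk ih =>
      have hk1 : 1 ≤ k := hk₀.trans hk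
      have hkpos : (0 : ℝ) < k := by exact_mod_cast hk1
      have hmono : ((k₀ : ℝ) / (k₀ + 1)) ^ α ≤ ((k : ℝ) / (k + 1)) ^ α := by
        apply Real.rpow_le_rpow (by positivity) _ hα0.le
        rw [div_le_div_iff₀ (by positivity) (by positivity)]
        have : (k₀ : ℝ) ≤ k := by exact_mod_cast hk
        nlinarith
      have hx_dev : ‖WithLp.toLp 2 (fun j => x j (k + 1) - a (k + 1))‖
          ≤ Cp * γ k * (1 + γ k₀) := by
        have hsplit : WithLp.toLp 2 (fun j => x j (k + 1) - a (k + 1))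
            = (1 - γ k) • WithLp.toLp 2 (fun i => v i k - a k)
              + γ k • WithLp.toLp 2 (fun i => u i k - b k) := by
          ext1 j
          exact hdev j k hk1
        have hu_norm := norm_toLp_le_sqrt_card_mul _ hρ0 fun i => hu_dev i k hk1
        rw [hsplit]
        refine (norm_add_le _ _).trans ?_
        rw [norm_smul, norm_smul, Real.norm_of_nonneg (sub_nonneg.mpr (hγ1 k hk1)),
          Real.norm_of_nonneg (hγ0 k)]
        have h1 := mul_le_mul_of_nonneg_left hu_norm (hγ0 k)
        have h2 : (1 - γ k) * ‖WithLp.toLp 2 (fun i => v i k - a k)‖ ≤ 1 * (Cp * γ k) :=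
          mul_le_mul (by linarith [hγ0 k]) ih (norm_nonneg _) zero_le_one
        rw [← hCpγ] at h1
        linarith
      simp only [hvdev]
      calc _ ≤ lam * ‖WithLp.toLp 2 (fun j => x j (k + 1) - a (k + 1))‖ :=
            norm_toLp_weighted_sum_le W hlam0 hW _ (hsum0 (k + 1))
        _ ≤ lam * (Cp * γ k * (1 + γ k₀)) := mul_le_mul_of_nonneg_left hx_dev hlam0
        _ = Cp * γ k * (lam * (1 + γ k₀)) := by ring
        _ ≤ Cp * γ k * ((k : ℝ) / (k + 1)) ^ α :=
            mul_le_mul_of_nonneg_left (hlamγ.trans hmono) (mul_nonneg hCp0 (hγ0 k))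
        _ = Cp * γ (k + 1) := by rw [mul_assoc, hratio k hk1]
  have hbound : ∀ i k, 1 ≤ k → ‖v i k - a k‖ ≤ Cp * γ k := fun i k hk =>
    (PiLp.norm_apply_le (WithLp.toLp 2 (fun i => v i k - a k)) i).trans
      ((le_total k k₀).elim (hsmall k hk) (hlarge k))
  have h2α : (1 : ℝ) ≤ 2 ^ α := Real.one_le_rpow one_le_two hα0.le
  intro i k hk
  obtain rfl | ⟨n, hn, rfl⟩ : k = 1 ∨ ∃ n, 1 ≤ n ∧ k = n + 1 := by
    rcases hk.eq_or_lt with h | h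
    · exact Or.inl h.symm
    · exact Or.inr ⟨k - 1, by omega, by omega⟩
  · have h1 : γ 1 = 1 := by simp [hγ]
    have h := hdist _ (hx1 i) _ (hmean (x · 1) hx1)
    rw [h1, mul_one]
    exact h.trans (by nlinarith)
  · have hnpos : (0 : ℝ) < n := by exact_mod_cast hn
    have hγn : γ n ≤ 2 ^ α * γ (n + 1) := by
      have h1 : 1 ≤ (2 : ℝ) ^ α * ((n : ℝ) / (n + 1)) ^ α := by
        rw [← Real.mul_rpow zero_le_two (by positivity)]
        apply Real.one_le_rpow _ hα0.le
        rw [← mul_div_assoc, one_le_div (by positivity)]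
        have : (1 : ℝ) ≤ n := by exact_mod_cast hn
        linarith
      rw [← hratio n hn]
      nlinarith [mul_le_mul_of_nonneg_left h1 (hγ0 n)]
    have h : ‖x i (n + 1) - a (n + 1)‖ ≤ (ρ + Cp) * γ n := by
      rw [hdev i n hn]
      refine (norm_add_le _ _).trans ?_
      rw [norm_smul, norm_smul, Real.norm_of_nonneg (sub_nonneg.mpr (hγ1 n hn)),
        Real.norm_of_nonneg (hγ0 n)]
      have h1 := mul_le_mul_of_nonneg_left (hu_dev i n hn) (hγ0 n)
      have h2 : (1 - γ n) * ‖v i n - a n‖ ≤ 1 * (Cp * γ n) :=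
        mul_le_mul (by linarith [hγ0 n]) (hbound i n hn) (norm_nonneg _) zero_le_one
      linarith
    calc _ ≤ (ρ + Cp) * γ n := h
      _ ≤ (2 * ρ + 3 * Cp) * (2 ^ α * γ (n + 1)) :=
          mul_le_mul (by linarith) hγn (hγ0 n) (by positivity)
      _ = _ := by ring
end

section
/- Under the stated setup, for every agent i ∈ {1,…,m} and every k ≥ 1 one has ‖x̄_i^{k+1} − x̄_i^k‖ ≤ (ρ̄ + 2C_p) γ_k. -/
/-- The `W`-weighted combinations `i ↦ ∑ j, W i j • v j` of a family of vectors. -/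
def mix {m : ℕ} {E : Type*} [AddCommGroup E] [Module ℝ E] (W : Matrix (Fin m) (Fin m) ℝ)
    (v : Fin m → E) (i : Fin m) : E :=
  ∑ j, W i j • v j

/-- The arithmetic mean of a finite family of vectors. -/
noncomputable def average {m : ℕ} {E : Type*} [AddCommGroup E] [Module ℝ E]
    (v : Fin m → E) : E :=
  (m : ℝ)⁻¹ • ∑ i, v i

section Module

variable {m : ℕ} {E : Type*} [AddCommGroup E] [Module ℝ E] {W : Matrix (Fin m) (Fin m) ℝ}

lemma mix_mem {s : Set E} (hs : Convex ℝ s) (hW : ∀ i j, 0 ≤ W i j)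
    (hrow : ∀ i, ∑ j, W i j = 1) {v : Fin m → E} (hv : ∀ i, v i ∈ s) (i : Fin m) :
    mix W v i ∈ s :=
  hs.sum_mem (fun j _ => hW i j) (hrow i) fun j _ => hv j

lemma average_mem {s : Set E} (hs : Convex ℝ s) (hm : 0 < m) {v : Fin m → E}
    (hv : ∀ i, v i ∈ s) : average v ∈ s := by
  rw [average, Finset.smul_sum]
  refine hs.sum_mem (fun _ _ => by positivity) ?_ fun j _ => hv j
  have : (m : ℝ) ≠ 0 := by positivity
  simp [this]

lemma average_mix (hcol : ∀ j, ∑ i, W i j = 1) (v : Fin m → E) :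
    average (mix W v) = average v := by
  simp only [average, mix]
  rw [Finset.sum_comm]
  simp [← Finset.sum_smul, hcol]

lemma average_combination (a b : ℝ) (v w : Fin m → E) :
    average (fun i => a • v i + b • w i) = a • average v + b • average w := by
  simp only [average, Finset.sum_add_distrib, ← Finset.smul_sum, smul_add]
  rw [smul_comm a, smul_comm b]

lemma sum_sub_average (hm : 0 < m) (v : Fin m → E) : ∑ i, (v i - average v) = 0 := by
  have : (m : ℝ) ≠ 0 := by positivity
  rw [Finset.sum_sub_distrib, Finset.sum_const, Finset.card_univ, Fintype.card_fin, average,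
    ← Nat.cast_smul_eq_nsmul ℝ, smul_inv_smul₀ this, sub_self]

lemma mix_sub_const (hrow : ∀ i, ∑ j, W i j = 1) (v : Fin m → E) (c : E) (i : Fin m) :
    mix W (fun j => v j - c) i = mix W v i - c := by
  simp [mix, smul_sub, Finset.sum_sub_distrib, ← Finset.sum_smul, hrow]

end Module

/-- A contraction estimate for scalar families of sum zero passes to families of vectors. -/
lemma norm_mix_le {m d : ℕ} {W : Matrix (Fin m) (Fin m) ℝ} {lam : ℝ} (hlam : 0 ≤ lam)
    (hW : ∀ y : Fin m → ℝ, ∑ i, y i = 0 →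
      Real.sqrt (∑ i, (∑ j, W i j * y j) ^ 2) ≤ lam * Real.sqrt (∑ i, (y i) ^ 2))
    (v : Fin m → EuclideanSpace ℝ (Fin d)) (hv : ∑ i, v i = 0) :
    ‖WithLp.toLp 2 (mix W v)‖ ≤ lam * ‖WithLp.toLp 2 v‖ := by
  have key (l : Fin d) : ∑ i, (∑ j, W i j * v j l) ^ 2 ≤ lam ^ 2 * ∑ i, (v i l) ^ 2 := by
    have h0 : ∑ i, v i l = 0 := by
      simpa using congrArg (fun w : EuclideanSpace ℝ (Fin d) => w l) hv
    have h := pow_le_pow_left₀ (Real.sqrt_nonneg _) (hW (fun i => v i l) h0) 2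
    rwa [mul_pow, Real.sq_sqrt (by positivity), Real.sq_sqrt (by positivity)] at h
  refine le_of_sq_le_sq ?_ (by positivity)
  rw [mul_pow, PiLp.norm_sq_eq_of_L2, PiLp.norm_sq_eq_of_L2]
  simp only [EuclideanSpace.real_norm_sq_eq]
  rw [Finset.sum_comm, Finset.sum_comm (f := fun i l => v i l ^ 2),
    Finset.mul_sum]
  refine Finset.sum_le_sum fun l _ => ?_
  simpa [mix] using key l

lemma norm_toLp_le_sqrt_mul {m : ℕ} {E : Type*} [NormedAddCommGroup E] {v : Fin m → E} {r : ℝ}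
    (hr : 0 ≤ r) (hv : ∀ i, ‖v i‖ ≤ r) : ‖WithLp.toLp 2 v‖ ≤ Real.sqrt m * r := by
  refine le_of_sq_le_sq ?_ (by positivity)
  rw [mul_pow, Real.sq_sqrt (by positivity), PiLp.norm_sq_eq_of_L2]
  calc ∑ i, ‖v i‖ ^ 2 ≤ ∑ _i : Fin m, r ^ 2 :=
        Finset.sum_le_sum fun i _ => pow_le_pow_left₀ (norm_nonneg _) (hv i) 2
    _ = m * r ^ 2 := by simp

/-- The step-size condition on `k₀` makes `C * k ^ (-α)` absorb one consensus step. -/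
lemma contraction_step_le {α lam : ℝ} (hα : 0 < α) {k₀ k : ℕ} (hk₀ : 1 ≤ k₀) (hk : k₀ ≤ k)
    (hlam : lam ≤ ((k₀ : ℝ) / ((k₀ : ℝ) + 1)) ^ α * (1 + (k₀ : ℝ) ^ (-α))⁻¹) {r : ℝ}
    (hr : 0 ≤ r) :
    lam * ((k₀ : ℝ) ^ α * r * (k : ℝ) ^ (-α) + (k : ℝ) ^ (-α) * r) ≤
      (k₀ : ℝ) ^ α * r * ((k + 1 : ℕ) : ℝ) ^ (-α) := by
  have hk₀' : (0 : ℝ) < k₀ := by exact_mod_cast hk₀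
  have hk' : (k₀ : ℝ) ≤ k := by exact_mod_cast hk
  have hkpos : (0 : ℝ) < k := hk₀'.trans_le hk'
  have hinv : (k₀ : ℝ) ^ α * (k₀ : ℝ) ^ (-α) = 1 := by
    rw [← Real.rpow_add hk₀']; simp
  have hratio : ((k₀ : ℝ) / ((k₀ : ℝ) + 1)) ^ α ≤ ((k : ℝ) / ((k : ℝ) + 1)) ^ α := by
    refine Real.rpow_le_rpow (by positivity) ?_ hα.le
    rw [div_le_div_iff₀ (by positivity) (by positivity)]
    nlinarith
  have hshift : ((k : ℝ) / ((k : ℝ) + 1)) ^ α * (k : ℝ) ^ (-α) = ((k + 1 : ℕ) : ℝ) ^ (-α) := by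
    rw [Real.div_rpow (by positivity) (by positivity), Real.rpow_neg (by positivity),
      Real.rpow_neg (by positivity)]
    have : (k : ℝ) ^ α ≠ 0 := by positivity
    push_cast
    field_simp
  have hpos : 0 < 1 + (k₀ : ℝ) ^ (-α) := by positivity
  have hlam' : lam * (1 + (k₀ : ℝ) ^ (-α)) ≤ ((k : ℝ) / ((k : ℝ) + 1)) ^ α :=
    ((le_mul_inv_iff₀ hpos).1 hlam).trans hratio
  calc lam * ((k₀ : ℝ) ^ α * r * (k : ℝ) ^ (-α) + (k : ℝ) ^ (-α) * r)
      = (k₀ : ℝ) ^ α * r * (k : ℝ) ^ (-α) * (lam * (1 + (k₀ : ℝ) ^ (-α))) := by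
        linear_combination (-lam * r * (k : ℝ) ^ (-α)) * hinv
    _ ≤ (k₀ : ℝ) ^ α * r * (k : ℝ) ^ (-α) * ((k : ℝ) / ((k : ℝ) + 1)) ^ α := by gcongr
    _ = _ := by rw [← hshift]; ring

theorem weighted_average_increment_bound (d m : ℕ) (hm : 0 < m)
    (Ω : Set (EuclideanSpace ℝ (Fin d))) (hne : Ω.Nonempty)
    (hconv : Convex ℝ Ω) (hcomp : IsCompact Ω)
    (ρ : ℝ) (hρ : ρ = Metric.diam Ω)
    (W : Matrix (Fin m) (Fin m) ℝ) (hWnn : ∀ i j, 0 ≤ W i j)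
    (hrow : ∀ i, ∑ j, W i j = 1) (hcol : ∀ j, ∑ i, W i j = 1)
    (lam : ℝ) (hlam0 : 0 ≤ lam) (hlam1 : lam < 1)
    (hW : ∀ y : Fin m → ℝ, ∑ i, y i = 0 →
      Real.sqrt (∑ i, (∑ j, W i j * y j) ^ 2) ≤ lam * Real.sqrt (∑ i, (y i) ^ 2))
    (α : ℝ) (hα0 : 0 < α) (hα1 : α ≤ 1)
    (γ : ℕ → ℝ) (hγ : ∀ k, γ k = (k : ℝ) ^ (-α))
    (k₀ : ℕ) (hk₀ : 1 ≤ k₀)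
    (hk₀lam : lam ≤ ((k₀ : ℝ) / ((k₀ : ℝ) + 1)) ^ α * (1 + (k₀ : ℝ) ^ (-α))⁻¹)
    (Cp : ℝ) (hCp : Cp = (k₀ : ℝ) ^ α * Real.sqrt (m : ℝ) * ρ)
    (x u : Fin m → ℕ → EuclideanSpace ℝ (Fin d))
    (hx1 : ∀ i, x i 1 ∈ Ω) (hu : ∀ i k, 1 ≤ k → u i k ∈ Ω)
    (hrec : ∀ i k, 1 ≤ k →
      x i (k + 1) = (1 - γ k) • (∑ j, W i j • x j k) + γ k • u i k) :
    ∀ i, ∀ k, 1 ≤ k →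
      ‖(∑ j, W i j • x j (k + 1)) - (∑ j, W i j • x j k)‖ ≤ (ρ + 2 * Cp) * γ k := by
  have hγpos (k : ℕ) (hk : 1 ≤ k) : 0 < γ k := by
    rw [hγ]
    have : (0 : ℝ) < k := by exact_mod_cast hk
    positivity
  have hγle (k : ℕ) (hk : 1 ≤ k) : γ k ≤ 1 := by
    rw [hγ]
    exact Real.rpow_le_one_of_one_le_of_nonpos (by exact_mod_cast hk) (by linarith)
  have hγanti {k l : ℕ} (hk : 1 ≤ k) (hkl : k ≤ l) : γ l ≤ γ k := by
    rw [hγ, hγ]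
    exact Real.rpow_le_rpow_of_nonpos (by exact_mod_cast hk) (by exact_mod_cast hkl)
      (by linarith)
  have hρ0 : 0 ≤ ρ := hρ ▸ Metric.diam_nonneg
  have hdiam {a b : EuclideanSpace ℝ (Fin d)} (ha : a ∈ Ω) (hb : b ∈ Ω) : ‖a - b‖ ≤ ρ := by
    rw [hρ, ← dist_eq_norm]
    exact Metric.dist_le_diam_of_mem hcomp.isBounded ha hb
  have hCp0 : 0 ≤ Cp := by rw [hCp]; positivity
  let X : ℕ → Fin m → EuclideanSpace ℝ (Fin d) := fun k i => x i k
  let U : ℕ → Fin m → EuclideanSpace ℝ (Fin d) := fun k i => u i k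
  have hX (k : ℕ) (hk : 1 ≤ k) :
      X (k + 1) = fun i => (1 - γ k) • mix W (X k) i + γ k • U k i :=
    funext fun i => hrec i k hk
  have hmem (k : ℕ) (hk : 1 ≤ k) : ∀ i, X k i ∈ Ω := by
    induction k, hk using Nat.le_induction with
    | base => exact hx1
    | succ k hk ih =>
      intro i
      rw [hX k hk]
      exact hconv (mix_mem hconv hWnn hrow ih i) (hu i k hk) (by linarith [hγle k hk])
        (hγpos k hk).le (by ring)
  have havg (k : ℕ) (hk : 1 ≤ k) :
      average (X (k + 1)) = (1 - γ k) • average (X k) + γ k • average (U k) := by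
    rw [hX k hk, average_combination, average_mix hcol]
  let Z : ℕ → PiLp 2 fun _ : Fin m => EuclideanSpace ℝ (Fin d) := fun k =>
    WithLp.toLp 2 fun i => mix W (X k) i - average (X k)
  have hstep (k : ℕ) (hk : 1 ≤ k) :
      ‖Z (k + 1)‖ ≤ lam * (‖Z k‖ + γ k * (Real.sqrt m * ρ)) := by
    have hmix : Z (k + 1) =
        WithLp.toLp 2 (mix W fun i => X (k + 1) i - average (X (k + 1))) :=
      congrArg (WithLp.toLp 2) (funext fun i => (mix_sub_const hrow _ _ i).symm)
    have hsplit : WithLp.toLp 2 (fun i => X (k + 1) i - average (X (k + 1))) =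
        (1 - γ k) • Z k + γ k • WithLp.toLp 2 fun i => U k i - average (U k) := by
      refine PiLp.ext fun i => ?_
      simp only [PiLp.add_apply, PiLp.smul_apply, Z]
      rw [havg k hk, hX k hk]
      module
    rw [hmix]
    refine (norm_mix_le hlam0 hW _ (sum_sub_average hm _)).trans
      (mul_le_mul_of_nonneg_left ?_ hlam0)
    rw [hsplit]
    refine (norm_add_le _ _).trans (add_le_add ?_ ?_)
    · rw [norm_smul, Real.norm_of_nonneg (by linarith [hγle k hk])]
      exact mul_le_of_le_one_left (norm_nonneg _) (by linarith [hγpos k hk])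
    · rw [norm_smul, Real.norm_of_nonneg (hγpos k hk).le]
      exact mul_le_mul_of_nonneg_left (norm_toLp_le_sqrt_mul hρ0 fun i =>
        hdiam (hu i k hk) (average_mem hconv hm fun j => hu j k hk)) (hγpos k hk).le
  have hinit (k : ℕ) (hk : 1 ≤ k) (hkk : k ≤ k₀) : ‖Z k‖ ≤ Cp * γ k := by
    have hk₀pos : (0 : ℝ) < k₀ := by exact_mod_cast hk₀
    have hCγ : Cp * γ k₀ = Real.sqrt m * ρ := by
      have hinv : (k₀ : ℝ) ^ α * (k₀ : ℝ) ^ (-α) = 1 := by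
        rw [← Real.rpow_add hk₀pos]; simp
      rw [hCp, hγ]
      linear_combination (Real.sqrt m * ρ) * hinv
    calc ‖Z k‖ ≤ Real.sqrt m * ρ := norm_toLp_le_sqrt_mul hρ0 fun i =>
          hdiam (mix_mem hconv hWnn hrow (hmem k hk) i) (average_mem hconv hm (hmem k hk))
      _ = Cp * γ k₀ := hCγ.symm
      _ ≤ Cp * γ k := mul_le_mul_of_nonneg_left (hγanti hk hkk) hCp0
  have hlate (k : ℕ) (hk : k₀ ≤ k) : ‖Z k‖ ≤ Cp * γ k := by
    induction k, hk using Nat.le_induction with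
    | base => exact hinit k₀ hk₀ le_rfl
    | succ k hk ih =>
      have h := contraction_step_le hα0 hk₀ hk hk₀lam
        (mul_nonneg (Real.sqrt_nonneg (m : ℝ)) hρ0)
      rw [← hγ, ← hγ, ← mul_assoc, ← hCp] at h
      refine (hstep k (hk₀.trans hk)).trans (le_trans ?_ h)
      gcongr
  have hcons (k : ℕ) (hk : 1 ≤ k) (i : Fin m) :
      ‖mix W (X k) i - average (X k)‖ ≤ Cp * γ k :=
    (PiLp.norm_apply_le (Z k) i).trans
      ((le_total k k₀).elim (hinit k hk) (hlate k))
  intro i k hk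
  have hdrift : ‖average (X (k + 1)) - average (X k)‖ ≤ γ k * ρ := by
    have : average (X (k + 1)) - average (X k) = γ k • (average (U k) - average (X k)) := by
      rw [havg k hk]; module
    rw [this, norm_smul, Real.norm_of_nonneg (hγpos k hk).le]
    exact mul_le_mul_of_nonneg_left (hdiam (average_mem hconv hm fun j => hu j k hk)
      (average_mem hconv hm (hmem k hk))) (hγpos k hk).le
  have hnext : ‖mix W (X (k + 1)) i - average (X (k + 1))‖ ≤ Cp * γ k :=
    (hcons (k + 1) (by omega) i).trans
      (mul_le_mul_of_nonneg_left (hγanti hk k.le_succ) hCp0)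
  have hcur := hcons k hk i
  rw [norm_sub_rev] at hcur
  have htri : ‖mix W (X (k + 1)) i - mix W (X k) i‖ ≤
      ‖mix W (X (k + 1)) i - average (X (k + 1))‖ +
        ‖average (X (k + 1)) - average (X k)‖ + ‖average (X k) - mix W (X k) i‖ := by
    simpa only [dist_eq_norm] using dist_triangle4 (mix W (X (k + 1)) i)
      (average (X (k + 1))) (average (X k)) (mix W (X k) i)
  change ‖mix W (X (k + 1)) i - mix W (X k) i‖ ≤ _
  linarith
end

section
/- Let Ω ⊆ ℝ^d be a nonempty convex compact set with diameter ρ̄ := max_{x,x̂∈Ω} ‖x − x̂‖. Let F : ℝ^d → ℝ be convex, differentiable and L-smooth, and let x* be a minimizer of F over Ω. Let γ_k := 2/(k+1), let E ≥ 0, and let x̄^k, ū^k ∈ Ω (k ≥ 1) satisfy the inexact Frank–Wolfe recursion x̄^{k+1} = (1 − γ_k) x̄^k + γ_k ū^k together with ⟨ū^k − x̄^k, ∇F(x̄^k)⟩ ≤ min_{u∈Ω} ⟨u − x̄^k, ∇F(x̄^k)⟩ + E γ_k for all k ≥ 1. Then for every k ≥ 1, F(x̄^k) − F(x*) ≤ max{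 2(F(x̄^1) − F(x*)), 2Lρ̄² + 4E } / (k + 1); in particular F(x̄^k) − F(x*) = O(1/k). -/
open scoped RealInnerProductSpace

section InnerProductSpace

variable {V : Type*} [NormedAddCommGroup V] [InnerProductSpace ℝ V] [CompleteSpace V]

theorem HasGradientAt.hasDerivAt_add_smul {F : V → ℝ} {g x v : V} {t : ℝ}
    (h : HasGradientAt F g (x + t • v)) :
    HasDerivAt (fun s : ℝ => F (x + s • v)) ⟪g, v⟫ t := by
  have hline : HasDerivAt (fun s : ℝ => x + s • v) v t := by
    simpa using ((hasDerivAt_id t).smul_const v).const_add x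
  simpa [Function.comp_def] using h.hasFDerivAt.comp_hasDerivAt t hline

/-- The descent lemma for a function with Lipschitz gradient. -/
theorem le_add_inner_add_of_gradient_lipschitz {F : V → ℝ} {F' : V → V} {L : ℝ}
    (hgrad : ∀ x, HasGradientAt F (F' x) x)
    (hsmooth : ∀ x y, ‖F' x - F' y‖ ≤ L * ‖x - y‖) (x v : V) :
    F (x + v) ≤ F x + ⟪v, F' x⟫ + L / 2 * ‖v‖ ^ 2 := by
  have hf (t : ℝ) : HasDerivAt (fun s : ℝ => F (x + s • v)) ⟪F' (x + t • v), v⟫ t :=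
    (hgrad _).hasDerivAt_add_smul
  have hB (t : ℝ) : HasDerivAt
      (fun s : ℝ => F x + s * ⟪v, F' x⟫ + L / 2 * ‖v‖ ^ 2 * s ^ 2)
      (⟪v, F' x⟫ + L * ‖v‖ ^ 2 * t) t := by
    have h := (((hasDerivAt_id t).mul_const ⟪v, F' x⟫).const_add (F x)).add
      (((hasDerivAt_id t).pow 2).const_mul (L / 2 * ‖v‖ ^ 2))
    refine h.congr_deriv ?_
    simp only [id_eq, Nat.cast_ofNat]
    ring
  have key := image_le_of_deriv_right_le_deriv_boundary
    (a := 0) (b := 1)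
    (fun t _ => (hf t).continuousAt.continuousWithinAt)
    (fun t _ => (hf t).hasDerivWithinAt)
    (by simp)
    (fun t _ => (hB t).continuousAt.continuousWithinAt)
    (fun t _ => (hB t).hasDerivWithinAt)
    (fun t ht => by
      have h1 : ⟪F' (x + t • v) - F' x, v⟫ ≤ ‖F' (x + t • v) - F' x‖ * ‖v‖ :=
        real_inner_le_norm _ _
      have h2 := hsmooth (x + t • v) x
      rw [add_sub_cancel_left, norm_smul, Real.norm_of_nonneg ht.1] at h2
      have h3 := mul_le_mul_of_nonneg_right h2 (norm_nonneg v)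
      rw [inner_sub_left, real_inner_comm v (F' x)] at h1
      linarith)
    (Set.right_mem_Icc.2 zero_le_one)
  simpa using key

/-- The first-order lower bound for a differentiable convex function. -/
theorem ConvexOn.add_inner_gradient_le {F : V → ℝ} (hF : ConvexOn ℝ Set.univ F) {g x : V}
    (hg : HasGradientAt F g x) (y : V) : F x + ⟪y - x, g⟫ ≤ F y := by
  have hconv : ConvexOn ℝ Set.univ (fun s : ℝ => F (x + s • (y - x))) := by
    have h := hF.comp_affineMap (AffineMap.lineMap x y : ℝ →ᵃ[ℝ] V)
    simpa [Function.comp_def, AffineMap.lineMap_apply, add_comm] using h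
  have hderiv : HasDerivAt (fun s : ℝ => F (x + s • (y - x))) ⟪g, y - x⟫ 0 :=
    HasGradientAt.hasDerivAt_add_smul (by simpa using hg)
  have h := hconv.le_slope_of_hasDerivAt (Set.mem_univ 0) (Set.mem_univ 1) zero_lt_one hderiv
  rw [slope_def_field] at h
  simp only [one_smul, zero_smul, add_zero, add_sub_cancel, sub_zero, div_one] at h
  rw [real_inner_comm] at h
  linarith

end InnerProductSpace

/-- A Lipschitz bound on a map controls squared distances in a bounded set by the squared
diameter, with no sign condition on the constant. -/
theorem mul_norm_sub_sq_le_mul_diam_sq {V : Type*} [NormedAddCommGroup V] {G : V → V} {L : ℝ}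
    (hG : ∀ x y, ‖G x - G y‖ ≤ L * ‖x - y‖) {Ω : Set V} (hΩ : Bornology.IsBounded Ω)
    {x y : V} (hx : x ∈ Ω) (hy : y ∈ Ω) :
    L * ‖x - y‖ ^ 2 ≤ L * Metric.diam Ω ^ 2 := by
  rcases le_or_gt 0 L with hL | hL
  · have h := Metric.dist_le_diam_of_mem hΩ hx hy
    rw [dist_eq_norm] at h
    gcongr
  · have heq (a b : V) : a = b := by
      by_contra hab
      have hpos : 0 < ‖a - b‖ := norm_pos_iff.2 (sub_ne_zero.2 hab)
      have h := (norm_nonneg _).trans (hG a b)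
      nlinarith
    have hdiam : Metric.diam Ω = 0 := Metric.diam_subsingleton fun a _ b _ => heq a b
    simp [heq x y, hdiam]

/-- A nonnegative sequence contracting like the Frank–Wolfe gap decays at rate `1 / (k + 1)`. -/
theorem le_div_of_frankWolfe_recursion {h : ℕ → ℝ} {M : ℝ} (hM : 0 ≤ M) (h1 : 2 * h 1 ≤ M)
    (hstep : ∀ k : ℕ, 1 ≤ k →
      h (k + 1) ≤ (1 - 2 / ((k : ℝ) + 1)) * h k + (2 / ((k : ℝ) + 1)) ^ 2 * (M / 4))
    (k : ℕ) (hk : 1 ≤ k) : h k ≤ M / ((k : ℝ) + 1) := by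
  induction k, hk using Nat.le_induction with
  | base => norm_num; linarith
  | succ k hk ih =>
    have hk' : (1 : ℝ) ≤ k := by exact_mod_cast hk
    have hγ : 0 ≤ 1 - 2 / ((k : ℝ) + 1) := by
      rw [sub_nonneg, div_le_one (by positivity)]
      linarith
    calc h (k + 1)
        ≤ (1 - 2 / ((k : ℝ) + 1)) * (M / ((k : ℝ) + 1)) + (2 / ((k : ℝ) + 1)) ^ 2 * (M / 4) :=
          (hstep k hk).trans (by gcongr)
      _ = M * k / ((k : ℝ) + 1) ^ 2 := by field_simp; ring
      _ ≤ M / (((k + 1 : ℕ) : ℝ) + 1) := by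
          push_cast
          rw [div_le_div_iff₀ (by positivity) (by positivity)]
          nlinarith

/-- Convergence rate of the inexact Frank–Wolfe recursion for a convex,
`L`-smooth objective: with step sizes `γ_k = 2/(k+1)` and inexactness `E γ_k`
in the linear-minimization step,
`F(x̄^k) − F(x*) ≤ max{2(F(x̄^1) − F(x*)), 2Lρ̄² + 4E}/(k+1)`. -/
theorem convex_fw_rate (d : ℕ) (Ω : Set (EuclideanSpace ℝ (Fin d)))
    (hne : Ω.Nonempty) (hcomp : IsCompact Ω) (hconv : Convex ℝ Ω)
    (ρ : ℝ) (hρ : ρ = Metric.diam Ω)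
    (F : EuclideanSpace ℝ (Fin d) → ℝ)
    (F' : EuclideanSpace ℝ (Fin d) → EuclideanSpace ℝ (Fin d))
    (L : ℝ)
    (hFconv : ConvexOn ℝ Set.univ F)
    (hgrad : ∀ x, HasGradientAt F (F' x) x)
    (hsmooth : ∀ x y, ‖F' x - F' y‖ ≤ L * ‖x - y‖)
    (xstar : EuclideanSpace ℝ (Fin d)) (hxstar : xstar ∈ Ω)
    (hmin : ∀ x ∈ Ω, F xstar ≤ F x)
    (γ : ℕ → ℝ) (hγ : ∀ k : ℕ, γ k = 2 / ((k : ℝ) + 1))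
    (E : ℝ) (hE : 0 ≤ E)
    (xb ub : ℕ → EuclideanSpace ℝ (Fin d))
    (hxb : ∀ k, 1 ≤ k → xb k ∈ Ω) (hub : ∀ k, 1 ≤ k → ub k ∈ Ω)
    (hrec : ∀ k, 1 ≤ k → xb (k + 1) = (1 - γ k) • xb k + γ k • ub k)
    (hineq : ∀ k, 1 ≤ k → ∀ u ∈ Ω,
      ⟪ub k - xb k, F' (xb k)⟫ ≤ ⟪u - xb k, F' (xb k)⟫ + E * γ k) :
    ∀ k : ℕ, 1 ≤ k →
      F (xb k) - F xstar ≤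
        max (2 * (F (xb 1) - F xstar)) (2 * L * ρ ^ 2 + 4 * E) / ((k : ℝ) + 1) := by
  intro k hk
  have hC : 0 ≤ F (xb 1) - F xstar := sub_nonneg.2 (hmin _ (hxb 1 le_rfl))
  refine le_div_of_frankWolfe_recursion (h := fun k => F (xb k) - F xstar)
    (le_max_of_le_left (by linarith)) (le_max_left _ _) (fun k hk => ?_) k hk
  have hstep : xb (k + 1) = xb k + γ k • (ub k - xb k) := by
    rw [hrec k hk]
    module
  have hdescent := le_add_inner_add_of_gradient_lipschitz hgrad hsmooth (xb k)
    (γ k • (ub k - xb k))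
  rw [← hstep, real_inner_smul_left, norm_smul, mul_pow, Real.norm_eq_abs, sq_abs] at hdescent
  have hdiam := mul_norm_sub_sq_le_mul_diam_sq hsmooth hcomp.isBounded (hub k hk) (hxb k hk)
  rw [← hρ] at hdiam
  have hgap := hFconv.add_inner_gradient_le (hgrad (xb k)) xstar
  have hmax := le_max_right (2 * (F (xb 1) - F xstar)) (2 * L * ρ ^ 2 + 4 * E)
  have hγ0 : 0 ≤ γ k := by
    rw [hγ]
    positivity
  have hlin := mul_le_mul_of_nonneg_left (hineq k hk xstar hxstar) hγ0
  have hgap' := mul_le_mul_of_nonneg_left hgap hγ0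
  have hdiam' := mul_le_mul_of_nonneg_left hdiam (sq_nonneg (γ k))
  have hmax' := mul_le_mul_of_nonneg_left hmax (sq_nonneg (γ k))
  simp only [← hγ k]
  linarith
end

section
/- Let Ω ⊆ ℝ^d be a nonempty convex compact set with diameter ρ̄ := max_{x,x̂∈Ω} ‖x − x̂‖. Let F : ℝ^d → ℝ be differentiable, L-smooth, and G-Lipschitz on Ω (|F(x) − F(y)| ≤ G‖x − y‖ for x, y ∈ Ω). Fix α ∈ (0,1), set γ_k := k^{−α}, and define the Frank–Wolfe gap g_k := max_{x∈Ω} ⟨∇F(x̄^k), x̄^k − x⟩. Suppose x̄^k, ū^k ∈ Ω (k ≥ 1) satisfy x̄^{k+1} = (1 − γ_k) x̄^k + γ_k ū^k and ⟨ū^k − x̄^k, ∇F(x̄^k)⟩ ≤ −g_k + E γ_k for all k ≥ 1, where E ≥ 0, and set C₀ := E + Lρ̄²/2. Then for every even integer K ≥ 2: (i) if 1/2 ≤ α < 1, then min_{K/2+1 ≤ k ≤ K} g_k ≤ ((1−α)/(1 − (2/3)^{1−α})) (Gρ̄ + C₀ ln 2) K^{−(1−α)}; (ii) if 0 < α < 1/2,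 then min_{K/2+1 ≤ k ≤ K} g_k ≤ ((1−α)/(1 − (2/3)^{1−α})) (Gρ̄ + C₀ (1 − (1/2)^{1−2α})/(1 − 2α)) K^{−α}. In particular min_{K/2+1 ≤ k ≤ K} g_k = O(K^{−min{α, 1−α}}). -/
open scoped RealInnerProductSpace

/-- The descent lemma: a function with `L`-Lipschitz gradient lies below its quadratic upper
model. -/
theorem HasGradientAt.le_add_inner_add_sq {V : Type*} [NormedAddCommGroup V]
    [InnerProductSpace ℝ V] [CompleteSpace V] {F : V → ℝ} {F' : V → V} {L : ℝ}
    (hgrad : ∀ x, HasGradientAt F (F' x) x)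
    (hsmooth : ∀ x y, ‖F' x - F' y‖ ≤ L * ‖x - y‖) (x v : V) :
    F (x + v) ≤ F x + ⟪F' x, v⟫ + L / 2 * ‖v‖ ^ 2 := by
  set φ : ℝ → ℝ := fun t => F (x + t • v) - t * ⟪F' x, v⟫ - L / 2 * ‖v‖ ^ 2 * t ^ 2 with hφ
  have hder : ∀ t : ℝ,
      HasDerivAt φ (⟪F' (x + t • v), v⟫ - ⟪F' x, v⟫ - L * ‖v‖ ^ 2 * t) t := by
    intro t
    have hline : HasDerivAt (fun t : ℝ => x + t • v) v t := by
      simpa using ((hasDerivAt_id t).smul_const v).const_add x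
    have hF : HasDerivAt (fun t : ℝ => F (x + t • v)) ⟪F' (x + t • v), v⟫ t := by
      have h := (hgrad (x + t • v)).hasFDerivAt.comp_hasDerivAt t hline
      rw [InnerProductSpace.toDual_apply_apply] at h
      exact h
    have hlin : HasDerivAt (fun t : ℝ => t * ⟪F' x, v⟫) ⟪F' x, v⟫ t := by
      simpa using (hasDerivAt_id t).mul_const ⟪F' x, v⟫
    have hsq : HasDerivAt (fun t : ℝ => L / 2 * ‖v‖ ^ 2 * t ^ 2) (L * ‖v‖ ^ 2 * t) t := by
      refine ((hasDerivAt_pow 2 t).const_mul (L / 2 * ‖v‖ ^ 2)).congr_deriv ?_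
      norm_num
      ring
    exact (hF.sub hlin).sub hsq
  have hanti : AntitoneOn φ (Set.Icc 0 1) := by
    refine antitoneOn_of_deriv_nonpos (convex_Icc 0 1)
      (fun t _ => (hder t).continuousAt.continuousWithinAt)
      (fun t _ => (hder t).differentiableAt.differentiableWithinAt) fun t ht => ?_
    rw [interior_Icc] at ht
    have hgap : ⟪F' (x + t • v) - F' x, v⟫ ≤ L * ‖v‖ ^ 2 * t :=
      calc ⟪F' (x + t • v) - F' x, v⟫ ≤ ‖F' (x + t • v) - F' x‖ * ‖v‖ := real_inner_le_norm _ _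
        _ ≤ L * ‖x + t • v - x‖ * ‖v‖ := by gcongr; exact hsmooth _ _
        _ = L * ‖v‖ ^ 2 * t := by
          rw [add_sub_cancel_left, norm_smul, Real.norm_of_nonneg ht.1.le]
          ring
    rw [(hder t).deriv, ← inner_sub_left]
    linarith
  have h := hanti (Set.left_mem_Icc.2 zero_le_one) (Set.right_mem_Icc.2 zero_le_one) zero_le_one
  simp only [hφ, one_smul, zero_smul, add_zero] at h
  linarith

/-- The tangent-line bound for the concave function `x ↦ x ^ p`, `0 ≤ p ≤ 1`. -/
theorem Real.rpow_add_le_add_mul_rpow_sub_one {p x h : ℝ} (hp0 : 0 ≤ p) (hp1 : p ≤ 1)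
    (hx : 0 < x) (hh : 0 ≤ x + h) : (x + h) ^ p ≤ x ^ p + p * h * x ^ (p - 1) := by
  have hdiv : -1 ≤ h / x := by
    rw [le_div_iff₀ hx]
    linarith
  calc (x + h) ^ p = x ^ p * (1 + h / x) ^ p := by
        rw [← Real.mul_rpow hx.le (by linarith)]
        congr 1
        field_simp
    _ ≤ x ^ p * (1 + p * (h / x)) := by
        gcongr
        exact rpow_one_add_le_one_add_mul_self hdiv hp0 hp1
    _ = x ^ p + p * h * x ^ (p - 1) := by
        rw [Real.rpow_sub_one hx.ne']
        ring

/-- Left Riemann sums bound the integral of `t ^ (p - 1)` from above. -/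
theorem rpow_sub_rpow_le_mul_sum {p : ℝ} (hp0 : 0 ≤ p) (hp1 : p ≤ 1) {m : ℕ} (hm : 0 < m)
    (n : ℕ) :
    ((m + n : ℕ) : ℝ) ^ p - (m : ℝ) ^ p ≤
      p * ∑ i ∈ Finset.range n, ((m + i : ℕ) : ℝ) ^ (p - 1) := by
  have htel := Finset.sum_range_sub (fun i : ℕ => ((m + i : ℕ) : ℝ) ^ p) n
  rw [add_zero] at htel
  rw [← htel, Finset.mul_sum]
  refine Finset.sum_le_sum fun i _ => ?_
  have hpos : (0 : ℝ) < ((m + i : ℕ) : ℝ) := by exact_mod_cast (by omega : 0 < m + i)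
  have h := Real.rpow_add_le_add_mul_rpow_sub_one hp0 hp1 hpos (h := 1) (by linarith)
  rw [← add_assoc, Nat.cast_succ]
  linarith

/-- Right Riemann sums bound the integral of `t ^ (p - 1)` from below. -/
theorem mul_sum_le_rpow_sub_rpow {p : ℝ} (hp0 : 0 ≤ p) (hp1 : p ≤ 1) (m n : ℕ) :
    p * ∑ i ∈ Finset.range n, ((m + 1 + i : ℕ) : ℝ) ^ (p - 1) ≤
      ((m + n : ℕ) : ℝ) ^ p - (m : ℝ) ^ p := by
  have htel := Finset.sum_range_sub (fun i : ℕ => ((m + i : ℕ) : ℝ) ^ p) n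
  rw [add_zero] at htel
  rw [← htel, Finset.mul_sum]
  refine Finset.sum_le_sum fun i _ => ?_
  have hcast : ((m + i : ℕ) : ℝ) = ((m + 1 + i : ℕ) : ℝ) + -1 := by push_cast; ring
  have hpos : (0 : ℝ) < ((m + 1 + i : ℕ) : ℝ) := by positivity
  have h := Real.rpow_add_le_add_mul_rpow_sub_one hp0 hp1 hpos (h := -1)
    (hcast ▸ Nat.cast_nonneg _)
  rw [← hcast] at h
  rw [show m + (i + 1) = m + 1 + i by ring]
  linarith

theorem sum_inv_le_log_sub_log {m : ℕ} (hm : 0 < m) (n : ℕ) :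
    ∑ i ∈ Finset.range n, ((m + 1 + i : ℕ) : ℝ)⁻¹ ≤
      Real.log ((m + n : ℕ) : ℝ) - Real.log m := by
  have htel := Finset.sum_range_sub (fun i : ℕ => Real.log ((m + i : ℕ) : ℝ)) n
  rw [add_zero] at htel
  rw [← htel]
  refine Finset.sum_le_sum fun i _ => ?_
  have hpos : (0 : ℝ) < ((m + i : ℕ) : ℝ) := by exact_mod_cast (by omega : 0 < m + i)
  have hpos' : (0 : ℝ) < ((m + 1 + i : ℕ) : ℝ) := by positivity
  have h := Real.log_le_sub_one_of_pos (div_pos hpos hpos')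
  rw [Real.log_div hpos.ne' hpos'.ne'] at h
  have hq : ((m + i : ℕ) : ℝ) / ((m + 1 + i : ℕ) : ℝ) - 1 = -((m + 1 + i : ℕ) : ℝ)⁻¹ := by
    field_simp
    push_cast
    ring
  rw [show m + (i + 1) = m + 1 + i by ring]
  linarith

/-- Lower bound for the total step length over the second half of the iterations. -/
theorem one_sub_two_thirds_rpow_mul_le_sum {p : ℝ} (hp0 : 0 ≤ p) (hp1 : p ≤ 1) {n : ℕ}
    (hn : 0 < n) :
    (1 - (2 / 3 : ℝ) ^ p) * ((n + n : ℕ) : ℝ) ^ p ≤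
      p * ∑ i ∈ Finset.range n, ((n + 1 + i : ℕ) : ℝ) ^ (p - 1) := by
  have h := rpow_sub_rpow_le_mul_sum hp0 hp1 n.succ_pos n
  have hn1 : (1 : ℝ) ≤ n := by exact_mod_cast hn
  have hle : ((n + 1 : ℕ) : ℝ) ^ p ≤ (2 / 3 : ℝ) ^ p * ((n + 1 + n : ℕ) : ℝ) ^ p := by
    rw [← Real.mul_rpow (by norm_num) (Nat.cast_nonneg _)]
    refine Real.rpow_le_rpow (Nat.cast_nonneg _) ?_ hp0
    push_cast
    linarith
  have hmono : ((n + n : ℕ) : ℝ) ^ p ≤ ((n + 1 + n : ℕ) : ℝ) ^ p :=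
    Real.rpow_le_rpow (Nat.cast_nonneg _) (by exact_mod_cast (by omega : n + n ≤ n + 1 + n)) hp0
  have hc : (0 : ℝ) ≤ 1 - (2 / 3 : ℝ) ^ p :=
    sub_nonneg.2 (Real.rpow_le_one (by norm_num) (by norm_num) hp0)
  have := mul_le_mul_of_nonneg_left hmono hc
  simp only [Nat.succ_eq_add_one] at h
  linarith

/-- A weighted-average argument: a bound on the weighted sum of the `g k` over the second half of
the iterations bounds one of them. -/
theorem exists_le_of_sum_rpow_mul_le {α A : ℝ} (hα0 : 0 < α) (hα1 : α < 1) (hA : 0 ≤ A)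
    {g : ℕ → ℝ} {n : ℕ} (hn : 0 < n)
    (hsum : ∑ i ∈ Finset.range n, ((n + 1 + i : ℕ) : ℝ) ^ (-α) * g (n + 1 + i) ≤ A) :
    ∃ k, n + 1 ≤ k ∧ k ≤ n + n ∧
      g k ≤ (1 - α) / (1 - (2 / 3 : ℝ) ^ (1 - α)) * A * ((n + n : ℕ) : ℝ) ^ (-(1 - α)) := by
  set B := (1 - α) / (1 - (2 / 3 : ℝ) ^ (1 - α)) * A * ((n + n : ℕ) : ℝ) ^ (-(1 - α)) with hB
  have hlow := one_sub_two_thirds_rpow_mul_le_sum (p := 1 - α) (by linarith) (by linarith) hn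
  rw [show 1 - α - 1 = -α by ring] at hlow
  set S := ∑ i ∈ Finset.range n, ((n + 1 + i : ℕ) : ℝ) ^ (-α) with hS
  have hc : (0 : ℝ) < 1 - (2 / 3 : ℝ) ^ (1 - α) :=
    sub_pos.2 (Real.rpow_lt_one (by norm_num) (by norm_num) (by linarith))
  have hK : (0 : ℝ) < ((n + n : ℕ) : ℝ) ^ (1 - α) :=
    Real.rpow_pos_of_pos (by exact_mod_cast (by omega : 0 < n + n)) _
  have hAB : A ≤ B * S := by
    have hBS : B * S =
        A * ((1 - α) * S / ((1 - (2 / 3 : ℝ) ^ (1 - α)) * ((n + n : ℕ) : ℝ) ^ (1 - α))) := by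
      rw [hB, Real.rpow_neg (Nat.cast_nonneg _)]
      field_simp
    rw [hBS]
    exact le_mul_of_one_le_right hA ((one_le_div (mul_pos hc hK)).2 hlow)
  have hle : ∑ i ∈ Finset.range n, ((n + 1 + i : ℕ) : ℝ) ^ (-α) * g (n + 1 + i) ≤
      ∑ i ∈ Finset.range n, ((n + 1 + i : ℕ) : ℝ) ^ (-α) * B := by
    rw [← Finset.sum_mul, ← hS, mul_comm]
    exact hsum.trans hAB
  obtain ⟨i, hi, hgi⟩ := Finset.exists_le_of_sum_le ⟨0, Finset.mem_range.2 hn⟩ hle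
  have hin := Finset.mem_range.1 hi
  refine ⟨n + 1 + i, by omega, by omega, le_of_mul_le_mul_left hgi ?_⟩
  exact Real.rpow_pos_of_pos (by positivity) _

/-- Convergence rate of the inexact Frank–Wolfe recursion for a (possibly
non-convex) `L`-smooth, `G`-Lipschitz objective, measured via the Frank–Wolfe
gap `g_k = max_{x∈Ω} ⟪∇F(x̄^k), x̄^k − x⟫` with steps `γ_k = k^{−α}`:
for even `K ≥ 2`, `min_{K/2+1 ≤ k ≤ K} g_k` is bounded by
`((1−α)/(1−(2/3)^{1−α}))(Gρ̄ + C₀ ln 2) K^{−(1−α)}` when `1/2 ≤ α < 1`, and by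
`((1−α)/(1−(2/3)^{1−α}))(Gρ̄ + C₀(1−(1/2)^{1−2α})/(1−2α)) K^{−α}` when
`0 < α < 1/2`, where `C₀ = E + Lρ̄²/2`. -/
theorem nonconvex_fw_rate (d : ℕ) (Ω : Set (EuclideanSpace ℝ (Fin d)))
    (hne : Ω.Nonempty) (hcomp : IsCompact Ω) (hconv : Convex ℝ Ω)
    (ρ : ℝ) (hρ : ρ = Metric.diam Ω)
    (F : EuclideanSpace ℝ (Fin d) → ℝ)
    (F' : EuclideanSpace ℝ (Fin d) → EuclideanSpace ℝ (Fin d))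
    (L G : ℝ)
    (hgrad : ∀ x, HasGradientAt F (F' x) x)
    (hsmooth : ∀ x y, ‖F' x - F' y‖ ≤ L * ‖x - y‖)
    (hGLip : ∀ x ∈ Ω, ∀ y ∈ Ω, |F x - F y| ≤ G * ‖x - y‖)
    (α : ℝ) (hα0 : 0 < α) (hα1 : α < 1)
    (γ : ℕ → ℝ) (hγ : ∀ k : ℕ, γ k = (k : ℝ) ^ (-α))
    (xb ub : ℕ → EuclideanSpace ℝ (Fin d))
    (gk : ℕ → ℝ)
    (hgk : ∀ k, 1 ≤ k →
      IsGreatest ((fun x => ⟪F' (xb k), xb k - x⟫) '' Ω) (gk k))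
    (hxb : ∀ k, 1 ≤ k → xb k ∈ Ω) (hub : ∀ k, 1 ≤ k → ub k ∈ Ω)
    (hrec : ∀ k, 1 ≤ k → xb (k + 1) = (1 - γ k) • xb k + γ k • ub k)
    (E : ℝ) (hE : 0 ≤ E)
    (hineq : ∀ k, 1 ≤ k → ⟪ub k - xb k, F' (xb k)⟫ ≤ -gk k + E * γ k)
    (C₀ : ℝ) (hC₀ : C₀ = E + L * ρ ^ 2 / 2) :
    ∀ K : ℕ, 2 ≤ K → Even K →
      ((1 / 2 ≤ α → ∃ k, K / 2 + 1 ≤ k ∧ k ≤ K ∧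
        gk k ≤ (1 - α) / (1 - (2 / 3 : ℝ) ^ (1 - α)) * (G * ρ + C₀ * Real.log 2) *
          (K : ℝ) ^ (-(1 - α))) ∧
      (α < 1 / 2 → ∃ k, K / 2 + 1 ≤ k ∧ k ≤ K ∧
        gk k ≤ (1 - α) / (1 - (2 / 3 : ℝ) ^ (1 - α)) *
          (G * ρ + C₀ * (1 - (1 / 2 : ℝ) ^ (1 - 2 * α)) / (1 - 2 * α)) *
          (K : ℝ) ^ (-α))) := by
  have hdiam : ∀ x ∈ Ω, ∀ y ∈ Ω, ‖x - y‖ ≤ ρ := fun x hx y hy => by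
    rw [hρ, ← dist_eq_norm]
    exact Metric.dist_le_diam_of_mem hcomp.isBounded hx hy
  have hρ0 : 0 ≤ ρ := hρ ▸ Metric.diam_nonneg
  have hsign : ∀ c : ℝ, (∀ x ∈ Ω, ∀ y ∈ Ω, 0 ≤ c * ‖x - y‖) → 0 ≤ c ∨ ρ = 0 := by
    refine fun c hc => or_iff_not_imp_left.2 fun hneg => ?_
    rw [hρ]
    refine Metric.diam_subsingleton fun x hx y hy => ?_
    have h0 : ‖x - y‖ ≤ 0 := nonpos_of_mul_nonneg_right (hc x hx y hy) (not_le.1 hneg)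
    exact sub_eq_zero.1 (norm_le_zero_iff.1 h0)
  have hL := hsign L fun x _ y _ => (norm_nonneg _).trans (hsmooth x y)
  have hG := hsign G fun x hx y hy => (abs_nonneg _).trans (hGLip x hx y hy)
  have hLsq : ∀ x ∈ Ω, ∀ y ∈ Ω, L * ‖x - y‖ ^ 2 ≤ L * ρ ^ 2 := by
    intro x hx y hy
    have hxy := hdiam x hx y hy
    rcases hL with hL | hL
    · gcongr
    · rw [hL] at hxy ⊢
      rw [le_antisymm hxy (norm_nonneg _)]
  have hGρ : 0 ≤ G * ρ := by
    rcases hG with hG | hG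
    · positivity
    · simp [hG]
  have hC₀0 : 0 ≤ C₀ := by
    rw [hC₀]
    rcases hL with hL | hL
    · positivity
    · simpa [hL] using hE
  have hFdiff : ∀ x ∈ Ω, ∀ y ∈ Ω, F x - F y ≤ G * ρ := by
    intro x hx y hy
    refine ((le_abs_self _).trans (hGLip x hx y hy)).trans ?_
    have hxy := hdiam x hx y hy
    rcases hG with hG | hG
    · gcongr
    · rw [hG] at hxy ⊢
      rw [le_antisymm hxy (norm_nonneg _)]
  have hstep : ∀ k : ℕ, 1 ≤ k →
      (k : ℝ) ^ (-α) * gk k ≤ F (xb k) - F (xb (k + 1)) + C₀ * (k : ℝ) ^ (-2 * α) := by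
    intro k hk
    have hγ0 : 0 ≤ γ k := hγ k ▸ Real.rpow_nonneg (Nat.cast_nonneg _) _
    have hγsq : (k : ℝ) ^ (-2 * α) = γ k ^ 2 := by
      rw [hγ, ← Real.rpow_mul_natCast (Nat.cast_nonneg _)]
      congr 1
      push_cast
      ring
    have hnext : xb (k + 1) = xb k + γ k • (ub k - xb k) := by
      rw [hrec k hk]
      module
    have hdesc := HasGradientAt.le_add_inner_add_sq hgrad hsmooth (xb k) (γ k • (ub k - xb k))
    rw [← hnext, inner_smul_right, norm_smul, Real.norm_of_nonneg hγ0, real_inner_comm] at hdesc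
    have h1 := mul_le_mul_of_nonneg_left (hineq k hk) hγ0
    have h2 := mul_le_mul_of_nonneg_left (hLsq _ (hub k hk) _ (hxb k hk)) (sq_nonneg (γ k))
    rw [hγsq, ← hγ, hC₀]
    linarith
  intro K hK2 hKeven
  obtain ⟨n, rfl⟩ := hKeven
  have hn : 0 < n := by omega
  have hn0 : (0 : ℝ) < n := by exact_mod_cast hn
  have hnn0 : (0 : ℝ) < ((n + n : ℕ) : ℝ) := by exact_mod_cast (by omega : 0 < n + n)
  rw [show (n + n) / 2 = n by omega]
  have hsum : ∑ i ∈ Finset.range n, ((n + 1 + i : ℕ) : ℝ) ^ (-α) * gk (n + 1 + i) ≤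
      G * ρ + C₀ * ∑ i ∈ Finset.range n, ((n + 1 + i : ℕ) : ℝ) ^ (-2 * α) := by
    have htel := Finset.sum_range_sub' (fun i => F (xb (n + 1 + i))) n
    have hle := Finset.sum_le_sum fun i (_ : i ∈ Finset.range n) =>
      hstep (n + 1 + i) (by omega)
    simp only [← add_assoc] at htel
    rw [Finset.sum_add_distrib, htel, ← Finset.mul_sum] at hle
    have hends := hFdiff _ (hxb (n + 1 + 0) (by omega)) _ (hxb (n + 1 + n) (by omega))
    linarith
  constructor
  · intro hα
    refine exists_le_of_sum_rpow_mul_le hα0 hα1 (by positivity) hn (hsum.trans ?_)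
    gcongr
    have hlog : Real.log ((n + n : ℕ) : ℝ) - Real.log n = Real.log 2 := by
      rw [← Real.log_div hnn0.ne' hn0.ne']
      congr 1
      push_cast
      field_simp
      norm_num
    rw [← hlog]
    refine le_trans (Finset.sum_le_sum fun i _ => ?_) (sum_inv_le_log_sub_log hn n)
    rw [← Real.rpow_neg_one]
    refine Real.rpow_le_rpow_of_exponent_le ?_ (by linarith)
    exact_mod_cast (by omega : 1 ≤ n + 1 + i)
  · intro hα
    have hq : 0 < 1 - 2 * α := by linarith
    have hpow := mul_sum_le_rpow_sub_rpow (p := 1 - 2 * α) hq.le (by linarith) n n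
    rw [show 1 - 2 * α - 1 = -2 * α by ring] at hpow
    have hhalf : (n : ℝ) ^ (1 - 2 * α) =
        (1 / 2 : ℝ) ^ (1 - 2 * α) * ((n + n : ℕ) : ℝ) ^ (1 - 2 * α) := by
      rw [← Real.mul_rpow (by norm_num) hnn0.le]
      congr 1
      push_cast
      ring
    set c : ℝ := 1 - (1 / 2 : ℝ) ^ (1 - 2 * α) with hc
    have hc0 : 0 ≤ c :=
      sub_nonneg.2 (Real.rpow_le_one (by norm_num) (by norm_num) hq.le)
    set P : ℝ := ((n + n : ℕ) : ℝ) ^ (1 - 2 * α) with hP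
    have hP1 : 1 ≤ P :=
      Real.one_le_rpow (by exact_mod_cast (by omega : 1 ≤ n + n)) hq.le
    have hsq : ∑ i ∈ Finset.range n, ((n + 1 + i : ℕ) : ℝ) ^ (-2 * α) ≤ c * P / (1 - 2 * α) := by
      rw [le_div_iff₀ hq, hc]
      linarith
    obtain ⟨k, hk1, hk2, hk⟩ := exists_le_of_sum_rpow_mul_le
      (A := (G * ρ + C₀ * c / (1 - 2 * α)) * P) hα0 hα1 (by positivity) hn (hsum.trans (by
        calc _ ≤ G * ρ * P + C₀ * (c * P / (1 - 2 * α)) :=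
              add_le_add (le_mul_of_one_le_right hGρ hP1) (by gcongr)
          _ = _ := by ring))
    refine ⟨k, hk1, hk2, hk.trans_eq ?_⟩
    rw [show -α = (1 - 2 * α) + -(1 - α) by ring, Real.rpow_add hnn0, ← hP]
    ring
end
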